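/- A recurrent rooted network (G,c,o) has a unique potential if and only if every finite set A⊂V admits harmonic measure from infinity. In that case, for every z≠o the unique potential satisfies h(z) = ω_∞^{{o,z}}(z)·g_o(z,z). -/

import Mathlib

open scoped Classical
open Filter Topology MeasureTheory ProbabilityTheory

/-- A weighted network: an infinite, connected, locally finite graph with
positive edge conductances, encoded by a symmetric conductance function. -/
structure Network (V : Type*) where
  c : V → V → ℝ
  symm : ∀ x y, c x y = c y x
  nonneg : ∀ x y, 0 ≤ c x y
  locFin : ∀ x, {y | 0 < c x y}.Finite
  conn : ∀ x y, Relation.ReflTransGen (fun a b => 0 < c a b) x y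
  deg_pos : ∀ x, 0 < ∑' y, c x y
  infinite : Infinite V

namespace Network

variable {V : Type*} (N : Network V)

/-- Total conductance at a vertex. -/
noncomputable def cTot (x : V) : ℝ := ∑' y, N.c x y

/-- One-step transition probabilities of the network random walk. -/
noncomputable def p (x y : V) : ℝ := N.c x y / N.cTot x

/-- `n`-step transition probabilities of the network random walk. -/
noncomputable def pstep : ℕ → V → V → ℝ
  | 0, x, y => if x = y then 1 else 0
  | n + 1, x, y => ∑' z, pstep n x z * N.p z y

/-- The network random walk is recurrent: the expected number of returns is infinite. -/
def Recurrent : Prop := ∀ x : V, ¬ Summable (fun n => N.pstep n x x)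

/-- `avoid A n x y` is the probability that the walk started at `x` is at `y` at time `n`
without having visited the set `A` at any time `0,…,n`, i.e. `P_x(X_n = y, τ_A > n)`. -/
noncomputable def avoid (A : Set V) : ℕ → V → V → ℝ
  | 0, x, y => if x = y ∧ x ∉ A then 1 else 0
  | n + 1, x, y => if y ∈ A then 0 else ∑' z, avoid A n x z * N.p z y

/-- Green kernel of the walk killed at `o`:  `G_o(x,y) = Σ_n P_x(X_n = y, τ_o > n)`. -/
noncomputable def GreenK (o x y : V) : ℝ := ∑' n, N.avoid {o} n x y

/-- Green density of the walk killed at `o`:  `g_o(x,y) = G_o(x,y)/c_y`. -/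
noncomputable def g (o x y : V) : ℝ := N.GreenK o x y / N.cTot y

/-- The network Laplacian `Δf(v) = Σ_x c_{vx}(f(x) − f(v))`. -/
noncomputable def lap (f : V → ℝ) (v : V) : ℝ := ∑' x, N.c v x * (f x - f v)

/-- A potential on the rooted network `(G,c,o)`: a nonnegative function vanishing at `o`,
with Laplacian `1` at `o` and harmonic elsewhere. -/
def IsPotential (o : V) (h : V → ℝ) : Prop :=
  (∀ v, 0 ≤ h v) ∧ h o = 0 ∧ N.lap h o = 1 ∧ ∀ v, v ≠ o → N.lap h v = 0

/-- Harmonic measure from `v` on a set `A`:  `ω_v^A(z) = P_v(X_{τ_A} = z)`. -/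
noncomputable def harm (A : Set V) (v z : V) : ℝ :=
  if v ∈ A then (if v = z then 1 else 0)
  else if z ∈ A then ∑' n, ∑' w, N.avoid A n v w * N.p w z
  else 0

/-- Effective resistance `R_eff(x ↔ y) = g_x(y,y)`. -/
noncomputable def Reff (x y : V) : ℝ := N.g x y y

/-- Transition probabilities of the Doob `h`-transform: `p^h(x,y) = p(x,y) h(y)/h(x)`. -/
noncomputable def ph (h : V → ℝ) (x y : V) : ℝ := N.p x y * h y / h x

/-- `n`-step transition probabilities of the `h`-process. -/
noncomputable def phstep (h : V → ℝ) : ℕ → V → V → ℝ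
  | 0, x, y => if x = y then 1 else 0
  | n + 1, x, y => ∑' z, phstep h n x z * N.ph h z y

/-- The initial distribution `μ_h(v) = c_{ov} h(v)`. -/
noncomputable def muh (o : V) (h : V → ℝ) (v : V) : ℝ := N.c o v * h v

end Network

/-- `P` is the law of the Markov chain with initial distribution `μ` and transition
probabilities `q`, as a measure on trajectory space. -/
def IsChainLaw {S : Type*} [MeasurableSpace S] (μ : S → ℝ) (q : S → S → ℝ)
    (P : MeasureTheory.Measure (ℕ → S)) : Prop :=
  ∀ (n : ℕ) (v : ℕ → S),
    P {ω | ∀ i ≤ n, ω i = v i} =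
      ENNReal.ofReal (μ (v 0) * ∏ i ∈ Finset.range n, q (v i) (v (i + 1)))

namespace Network

variable {V : Type*} (N : Network V)

/-- The finite set of neighbours. -/
noncomputable def nb (x : V) : Finset V := (N.locFin x).toFinset

/-- One step averaging operator. -/
noncomputable def av (f : V → ℝ) (x : V) : ℝ := ∑ y ∈ N.nb x, N.p x y * f y

lemma mem_nb {x y : V} : y ∈ N.nb x ↔ 0 < N.c x y := by simp [nb]

lemma mem_nb_comm {x y : V} : y ∈ N.nb x ↔ x ∈ N.nb y := by
  rw [mem_nb, mem_nb, N.symm]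

lemma c_zero {x y : V} (h : y ∉ N.nb x) : N.c x y = 0 := by
  rw [mem_nb, not_lt] at h
  exact le_antisymm h (N.nonneg x y)

lemma p_zero {x y : V} (h : y ∉ N.nb x) : N.p x y = 0 := by
  simp [p, N.c_zero h]

lemma cTot_pos (x : V) : 0 < N.cTot x := N.deg_pos x

lemma cTot_eq (x : V) : N.cTot x = ∑ y ∈ N.nb x, N.c x y :=
  tsum_eq_sum fun _ hy => N.c_zero hy

lemma p_nonneg (x y : V) : 0 ≤ N.p x y := div_nonneg (N.nonneg x y) (N.cTot_pos x).le

lemma p_pos {x y : V} (h : y ∈ N.nb x) : 0 < N.p x y :=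
  div_pos (N.mem_nb.1 h) (N.cTot_pos x)

lemma sum_p (x : V) : ∑ y ∈ N.nb x, N.p x y = 1 := by
  simp only [p]
  rw [← Finset.sum_div, ← N.cTot_eq, div_self (N.cTot_pos x).ne']

lemma cTot_mul_p (x y : V) : N.cTot x * N.p x y = N.c x y := by
  rw [p, mul_div_cancel₀ _ (N.cTot_pos x).ne']

lemma tsum_col (f : V → ℝ) (y : V) :
    ∑' z, f z * N.p z y = ∑ z ∈ N.nb y, f z * N.p z y :=
  tsum_eq_sum fun z hz => by
    rw [N.mem_nb_comm] at hz
    simp [N.p_zero hz]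

lemma av_const (a : ℝ) (x : V) : N.av (fun _ => a) x = a := by
  simp only [av]
  rw [← Finset.sum_mul, N.sum_p, one_mul]

lemma av_mono {f g : V → ℝ} (h : ∀ y, f y ≤ g y) (x : V) : N.av f x ≤ N.av g x :=
  Finset.sum_le_sum fun y _ => mul_le_mul_of_nonneg_left (h y) (N.p_nonneg x y)

lemma av_add (f g : V → ℝ) (x : V) : N.av (fun y => f y + g y) x = N.av f x + N.av g x := by
  simp only [av, mul_add, Finset.sum_add_distrib]

lemma av_sum {ι : Type*} (s : Finset ι) (f : ι → V → ℝ) (x : V) :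
    N.av (fun y => ∑ i ∈ s, f i y) x = ∑ i ∈ s, N.av (f i) x := by
  simp only [av, Finset.mul_sum]
  rw [Finset.sum_comm]

lemma av_mul (a : ℝ) (f : V → ℝ) (x : V) : N.av (fun y => a * f y) x = a * N.av f x := by
  simp only [av, Finset.mul_sum]
  exact Finset.sum_congr rfl fun y _ => by ring

lemma lap_eq_sum (f : V → ℝ) (x : V) :
    N.lap f x = ∑ y ∈ N.nb x, N.c x y * (f y - f x) :=
  tsum_eq_sum fun y hy => by simp [N.c_zero hy]

lemma lap_eq (f : V → ℝ) (x : V) : N.lap f x = N.cTot x * (N.av f x - f x) := by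
  rw [lap_eq_sum, mul_sub, av, Finset.mul_sum]
  simp only [mul_sub, Finset.sum_sub_distrib]
  congr 1
  · exact Finset.sum_congr rfl fun y _ => by rw [← mul_assoc, cTot_mul_p]
  · rw [← Finset.sum_mul, ← cTot_eq]

lemma lap_nonpos_iff (f : V → ℝ) (x : V) : N.lap f x ≤ 0 ↔ N.av f x ≤ f x := by
  rw [lap_eq, ← sub_nonpos (a := N.av f x)]
  constructor
  · intro h
    by_contra h'
    push Not at h'
    have := mul_pos (N.cTot_pos x) h'
    linarith
  · intro h
    exact mul_nonpos_of_nonneg_of_nonpos (N.cTot_pos x).le h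

lemma lap_zero_iff (f : V → ℝ) (x : V) : N.lap f x = 0 ↔ N.av f x = f x := by
  rw [lap_eq, mul_eq_zero, sub_eq_zero]
  simp [(N.cTot_pos x).ne']

lemma lap_sub (f g : V → ℝ) (x : V) : N.lap (fun y => f y - g y) x = N.lap f x - N.lap g x := by
  simp only [lap_eq_sum, ← Finset.sum_sub_distrib]
  exact Finset.sum_congr rfl fun y _ => by ring

lemma lap_neg (f : V → ℝ) (x : V) : N.lap (fun y => - f y) x = - N.lap f x := by
  simp only [lap_eq_sum, ← Finset.sum_neg_distrib]
  exact Finset.sum_congr rfl fun y _ => by ring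

lemma lap_mul (a : ℝ) (f : V → ℝ) (x : V) : N.lap (fun y => a * f y) x = a * N.lap f x := by
  simp only [lap_eq_sum, Finset.mul_sum]
  exact Finset.sum_congr rfl fun y _ => by ring

lemma lap_const (a : ℝ) (x : V) : N.lap (fun _ => a) x = 0 := by
  simp [lap_eq_sum]

lemma lap_sum {ι : Type*} (s : Finset ι) (f : ι → V → ℝ) (x : V) :
    N.lap (fun y => ∑ i ∈ s, f i y) x = ∑ i ∈ s, N.lap (f i) x := by
  simp only [lap_eq_sum, ← Finset.sum_sub_distrib, Finset.mul_sum]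
  rw [Finset.sum_comm]

/-- Lyapunov bound. -/
lemma lyap (A : Set V) (b : ℕ → V → ℝ) (u : V → ℝ) (hu : ∀ x, 0 ≤ u x)
    (h0 : ∀ x, b 0 x + (if x ∈ A then 0 else N.av u x) ≤ u x)
    (hb : ∀ n x, b (n + 1) x = if x ∈ A then 0 else N.av (b n) x) (n : ℕ) :
    ∀ x, ∑ k ∈ Finset.range n, b k x ≤ u x := by
  induction n with
  | zero => simpa using hu
  | succ n ih =>
    intro x
    rw [Finset.sum_range_succ']
    refine le_trans ?_ (h0 x)
    rw [add_comm]
    gcongr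
    simp only [hb]
    split_ifs with hx
    · simp
    · rw [← N.av_sum]
      exact N.av_mono ih x

lemma lyap_summable (A : Set V) (b : ℕ → V → ℝ) (u : V → ℝ) (hu : ∀ x, 0 ≤ u x)
    (hpos : ∀ n x, 0 ≤ b n x)
    (h0 : ∀ x, b 0 x + (if x ∈ A then 0 else N.av u x) ≤ u x)
    (hb : ∀ n x, b (n + 1) x = if x ∈ A then 0 else N.av (b n) x) (x : V) :
    Summable (fun n => b n x) :=
  summable_of_sum_range_le (fun n => hpos n x) fun n => N.lyap A b u hu h0 hb n x

lemma lyap_tsum_le (A : Set V) (b : ℕ → V → ℝ) (u : V → ℝ) (hu : ∀ x, 0 ≤ u x)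
    (hpos : ∀ n x, 0 ≤ b n x)
    (h0 : ∀ x, b 0 x + (if x ∈ A then 0 else N.av u x) ≤ u x)
    (hb : ∀ n x, b (n + 1) x = if x ∈ A then 0 else N.av (b n) x) (x : V) :
    ∑' n, b n x ≤ u x :=
  Real.tsum_le_of_sum_range_le (fun n => hpos n x) fun n => N.lyap A b u hu h0 hb n x

lemma tsum_step (A : Set V) (b : ℕ → V → ℝ) (hs : ∀ x, Summable (fun n => b n x))
    (hb : ∀ n x, b (n + 1) x = if x ∈ A then 0 else N.av (b n) x) (x : V) :
    ∑' n, b n x = b 0 x + if x ∈ A then 0 else N.av (fun y => ∑' n, b n y) x := by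
  rw [(hs x).tsum_eq_zero_add]
  congr 1
  simp only [hb]
  split_ifs with hx
  · simp
  · simp only [av]
    rw [Summable.tsum_finsetSum (fun y _ => (hs y).mul_left _)]
    exact Finset.sum_congr rfl fun y _ => tsum_mul_left

lemma avoid_succ (A : Set V) (n : ℕ) (x y : V) :
    N.avoid A (n + 1) x y = if y ∈ A then 0 else ∑ z ∈ N.nb y, N.avoid A n x z * N.p z y := by
  rw [avoid, tsum_col]

lemma avoid_succ' (A : Set V) (n : ℕ) : ∀ x y : V,
    N.avoid A (n + 1) x y = if x ∈ A then 0 else N.av (fun z => N.avoid A n z y) x := by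
  induction n with
  | zero =>
    intro x y
    rw [avoid_succ]
    simp only [avoid, av]
    by_cases hx : x ∈ A
    · simp only [hx]
      simp
    by_cases hy : y ∈ A
    · simp only [hx, hy, if_true, if_false]
      symm
      refine Finset.sum_eq_zero fun z _ => ?_
      rw [if_neg, mul_zero]
      rintro ⟨rfl, h⟩
      exact h hy
    · simp only [hx, hy, if_false, not_false_eq_true, and_true, ite_mul, one_mul, zero_mul]
      rw [Finset.sum_ite_eq]
      have : ∀ z, N.p x z * (if z = y ∧ z ∉ A then (1 : ℝ) else 0)
          = if z = y then N.p x z else 0 := by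
        intro z
        by_cases hz : z = y
        · subst hz; simp [hy]
        · simp [hz]
      simp only [this]
      rw [Finset.sum_ite_eq']
      simp only [N.mem_nb_comm (x := x)]
  | succ n ih =>
    intro x y
    rw [avoid_succ]
    have e : (fun z => N.avoid A (n + 1) z y) = fun z =>
      if y ∈ A then 0 else ∑ w ∈ N.nb y, N.avoid A n z w * N.p w y :=
      funext fun z => N.avoid_succ A n z y
    rw [e]
    simp only [ih]
    by_cases hx : x ∈ A
    · simp [hx]
    simp only [hx, if_false]
    by_cases hy : y ∈ A
    · simp [hy, av]
    simp only [hy, if_false, av, Finset.mul_sum, Finset.sum_mul]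
    rw [Finset.sum_comm]
    exact Finset.sum_congr rfl fun _ _ => Finset.sum_congr rfl fun _ _ => by ring

lemma avoid_nonneg (A : Set V) (n : ℕ) : ∀ x y : V, 0 ≤ N.avoid A n x y := by
  induction n with
  | zero => intro x y; simp only [avoid]; split_ifs <;> norm_num
  | succ n ih =>
    intro x y
    rw [avoid_succ]
    split_ifs
    · exact le_rfl
    · exact Finset.sum_nonneg fun z _ => mul_nonneg (ih _ _) (N.p_nonneg _ _)

lemma avoid_symm (A : Set V) (n : ℕ) : ∀ x y : V,
    N.cTot x * N.avoid A n x y = N.cTot y * N.avoid A n y x := by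
  induction n with
  | zero =>
    intro x y
    simp only [avoid]
    by_cases h : x = y
    · subst h; rfl
    · simp [h, Ne.symm h]
  | succ n ih =>
    intro x y
    rw [avoid_succ, avoid_succ']
    split_ifs
    · simp
    · rw [av, Finset.mul_sum, Finset.mul_sum]
      refine Finset.sum_congr rfl fun z _ => ?_
      rw [← mul_assoc, ih, ← mul_assoc, cTot_mul_p, N.symm y z, ← N.cTot_mul_p z y]
      ring

lemma pstep_eq (n : ℕ) : ∀ x y : V, N.pstep n x y = N.avoid ∅ n x y := by
  induction n with
  | zero => intro x y; simp [pstep, avoid]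
  | succ n ih => intro x y; simp [pstep, avoid, ih]

/-- A harmonic function attaining its maximum is constant, path version. -/
lemma max_step {f : V → ℝ} {M : ℝ} (hM : ∀ y, f y ≤ M) {x : V} (hx : f x = M)
    (hf : M ≤ N.av f x) {y : V} (hy : y ∈ N.nb x) : f y = M := by
  by_contra hne
  have hlt : f y < M := lt_of_le_of_ne (hM y) hne
  have : N.av f x < N.av (fun _ => M) x :=
    Finset.sum_lt_sum (fun z _ => mul_le_mul_of_nonneg_left (hM z) (N.p_nonneg x z))
      ⟨y, hy, mul_lt_mul_of_pos_left hlt (N.p_pos hy)⟩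
  rw [av_const] at this
  linarith

variable {N}

lemma superharm_harm (hrec : N.Recurrent) {w : V → ℝ} (hw : ∀ x, 0 ≤ w x)
    (hs : ∀ x, N.av w x ≤ w x) (x : V) : N.av w x = w x := by
  by_contra hne
  have hlt : 0 < w x - N.av w x := sub_pos.2 (lt_of_le_of_ne (hs x) hne)
  set ε := w x - N.av w x with hε
  apply hrec x
  have key := N.lyap_summable ∅ (fun n y => ε * N.avoid ∅ n y x) w hw
    (fun n y => mul_nonneg hlt.le (N.avoid_nonneg _ _ _ _)) ?_ ?_ x
  · have := key.mul_left ε⁻¹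
    refine this.congr fun n => ?_
    rw [pstep_eq, inv_mul_cancel_left₀ hlt.ne']
  · intro y
    simp only [avoid, Set.mem_empty_iff_false, not_false_eq_true, and_true, if_false]
    by_cases h : y = x
    · subst h; simp [hε]
    · simpa [h] using hs y
  · intro n y
    simp only [avoid_succ', av_mul]
    simp

lemma superharm_const (hrec : N.Recurrent) {w : V → ℝ} (hw : ∀ x, 0 ≤ w x)
    (hs : ∀ x, N.av w x ≤ w x) (x y : V) : w x = w y := by
  have key : ∀ x y, w x ≤ w y := by
    intro x y
    have hm := superharm_harm hrec (w := fun z => min (w z) (w x)) (fun z => le_min (hw z) (hw x))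
      (fun z => le_min ((N.av_mono (fun y => min_le_left _ _) z).trans (hs z))
        ((N.av_mono (fun y => min_le_right _ _) z).trans (N.av_const _ z).le))
    have : (fun z => min (w z) (w x)) y = w x := by
      induction N.conn x y with
      | refl => simp
      | tail _ hbc ih =>
        exact N.max_step (fun y => min_le_right _ _) ih ((hm _).trans ih).ge (N.mem_nb.2 hbc)
    simpa using this
  exact le_antisymm (key x y) (key y x)

/-- Minimum principle. -/
lemma min_principle (hrec : N.Recurrent) {A : Set V} {o : V} (ho : o ∈ A) {f : V → ℝ} {C : ℝ}
    (hC : ∀ x, -C ≤ f x) (hA : ∀ x ∈ A, 0 ≤ f x) (hs : ∀ x, x ∉ A → N.lap f x ≤ 0) (x : V) :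
    0 ≤ f x := by
  have hC0 : ∀ y, 0 ≤ min (f y) 0 + |C| := by
    intro y
    have := hC y
    have h1 := le_abs_self C
    have h2 := abs_nonneg C
    rcases min_choice (f y) 0 with h | h <;> rw [h] <;> linarith
  have h := superharm_const hrec (w := fun y => min (f y) 0 + |C|) hC0 (fun y => ?_) x o
  · simp only [min_eq_right (hA o ho)] at h
    have : min (f x) 0 = 0 := by linarith
    simpa using this
  · rw [N.av_add, N.av_const]
    gcongr
    refine le_min ?_ ((N.av_mono (fun z => min_le_right _ _) y).trans (N.av_const _ y).le)
    by_cases hy : y ∈ A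
    · exact ((N.av_mono (fun z => min_le_right _ _) y).trans (N.av_const _ y).le).trans (hA y hy)
    · exact (N.av_mono (fun z => min_le_left _ _) y).trans ((N.lap_nonpos_iff _ _).1 (hs y hy))

lemma bdd_unique (hrec : N.Recurrent) {o : V} {f : V → ℝ} {C : ℝ}
    (hC : ∀ x, |f x| ≤ C) (ho : f o = 0) (hs : ∀ x, x ≠ o → N.lap f x = 0) (x : V) :
    f x = 0 := by
  refine le_antisymm ?_ ?_
  · have := min_principle hrec (A := {o}) (o := o) rfl (f := fun y => - f y) (C := C)
      (fun y => neg_le_neg (abs_le.1 (hC y)).2) (by simp [ho])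
      (fun y hy => by rw [lap_neg, hs y hy, neg_zero]) x
    linarith
  · exact min_principle hrec (A := {o}) (o := o) rfl (C := C)
      (fun y => (abs_le.1 (hC y)).1) (by simp [ho]) (fun y hy => (hs y hy).le) x

variable (N)

/-- Hitting `z` at time `n+1`. -/
noncomputable def hitp (A : Set V) (z : V) (n : ℕ) (v : V) : ℝ :=
  ∑ w ∈ N.nb z, N.avoid A n v w * N.p w z

lemma hitp_nonneg (A : Set V) (z : V) (n : ℕ) (v : V) : 0 ≤ N.hitp A z n v :=
  Finset.sum_nonneg fun w _ => mul_nonneg (N.avoid_nonneg _ _ _ _) (N.p_nonneg _ _)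

lemma hitp_zero (A : Set V) (z v : V) : N.hitp A z 0 v = if v ∈ A then 0 else N.p v z := by
  simp only [hitp, avoid]
  by_cases hv : v ∈ A
  · simp [hv]
  · simp only [hv, not_false_eq_true, and_true, ite_mul, one_mul, zero_mul, Finset.sum_ite_eq,
      if_false]
    split_ifs with h
    · rfl
    · rw [N.mem_nb_comm] at h
      rw [N.p_zero h]

lemma hitp_succ (A : Set V) (z : V) (n : ℕ) (v : V) :
    N.hitp A z (n + 1) v = if v ∈ A then 0 else N.av (N.hitp A z n) v := by
  simp only [hitp, avoid_succ']
  split_ifs with hv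
  · simp
  · have e : N.hitp A z n = fun y => ∑ w ∈ N.nb z, N.avoid A n y w * N.p w z := rfl
    rw [e, N.av_sum]
    refine Finset.sum_congr rfl fun w _ => ?_
    rw [mul_comm, ← N.av_mul]
    simp only [mul_comm]

lemma hit_lyap (A : Set V) {z : V} (hz : z ∈ A) (x : V) :
    N.hitp A z 0 x + (if x ∈ A then 0 else N.av (fun y => if y ∈ A then (0 : ℝ) else 1) x)
      ≤ (if x ∈ A then (0 : ℝ) else 1) := by
  rw [hitp_zero]
  split_ifs with hx
  · simp
  · have h1 : N.p x z = N.av (fun y => if y = z then (1 : ℝ) else 0) x := by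
      simp only [av, mul_ite, mul_one, mul_zero, Finset.sum_ite_eq']
      split_ifs with h
      · rfl
      · exact N.p_zero h
    rw [h1, ← N.av_add]
    refine (N.av_mono (g := fun _ => (1 : ℝ)) (fun y => ?_) x).trans (N.av_const _ x).le
    by_cases hy : y = z
    · subst hy; simp [hz]
    · simp only [hy, if_false, zero_add]; split_ifs <;> norm_num

lemma hit_summable (A : Set V) {z : V} (hz : z ∈ A) (x : V) :
    Summable (fun n => N.hitp A z n x) :=
  N.lyap_summable A (N.hitp A z) (fun y => if y ∈ A then (0 : ℝ) else 1)
    (fun y => by split_ifs <;> norm_num) (N.hitp_nonneg A z) (N.hit_lyap A hz) (N.hitp_succ A z) x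

lemma harm_off (A : Set V) {z v : V} (hz : z ∈ A) (hv : v ∉ A) :
    N.harm A v z = ∑' n, N.hitp A z n v := by
  simp only [harm, hz, hv, if_true, if_false, tsum_col, hitp]

lemma harm_on (A : Set V) {z v : V} (hv : v ∈ A) :
    N.harm A v z = if v = z then 1 else 0 := by
  simp only [harm, hv, if_true]

lemma harm_nonneg (A : Set V) {z : V} (hz : z ∈ A) (v : V) : 0 ≤ N.harm A v z := by
  by_cases hv : v ∈ A
  · rw [N.harm_on A hv]; split_ifs <;> norm_num
  · rw [N.harm_off A hz hv]
    exact tsum_nonneg fun n => N.hitp_nonneg _ _ _ _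

lemma harm_le_one (A : Set V) {z : V} (hz : z ∈ A) (v : V) : N.harm A v z ≤ 1 := by
  by_cases hv : v ∈ A
  · rw [N.harm_on A hv]; split_ifs <;> norm_num
  · rw [N.harm_off A hz hv]
    refine (N.lyap_tsum_le A (N.hitp A z) (fun y => if y ∈ A then (0 : ℝ) else 1)
      (fun y => by split_ifs <;> norm_num) (N.hitp_nonneg A z) (N.hit_lyap A hz)
      (N.hitp_succ A z) v).trans ?_
    simp [hv]

lemma harm_abs (A : Set V) {z : V} (hz : z ∈ A) (v : V) : |N.harm A v z| ≤ 1 := by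
  rw [abs_of_nonneg (N.harm_nonneg A hz v)]
  exact N.harm_le_one A hz v

lemma harm_av (A : Set V) {z : V} (hz : z ∈ A) {v : V} (hv : v ∉ A) :
    N.av (fun y => N.harm A y z) v = N.harm A v z := by
  rw [N.harm_off A hz hv, N.tsum_step A _ (N.hit_summable A hz) (N.hitp_succ A z), hitp_zero,
    if_neg hv, if_neg hv]
  have h1 : N.p v z = N.av (fun y => if y = z then (1 : ℝ) else 0) v := by
    simp only [av, mul_ite, mul_one, mul_zero, Finset.sum_ite_eq']
    split_ifs with h
    · rfl
    · exact N.p_zero h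
  rw [h1, ← N.av_add]
  congr 1
  ext y
  by_cases hy : y ∈ A
  · rw [N.harm_on A hy, N.tsum_step A _ (N.hit_summable A hz) (N.hitp_succ A z), hitp_zero]
    simp [hy]
  · have : y ≠ z := fun h => hy (h ▸ hz)
    rw [N.harm_off A hz hy]
    simp [this]

lemma harm_lap (A : Set V) {z : V} (hz : z ∈ A) {v : V} (hv : v ∉ A) :
    N.lap (fun y => N.harm A y z) v = 0 :=
  (N.lap_zero_iff _ _).2 (N.harm_av A hz hv)

/-- Existence of a bound function for the Green kernel. -/
lemma green_bound (o y : V) (hy : y ≠ o) :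
    ∃ ε : ℝ, 0 < ε ∧ ∀ x, ε * N.avoid {o} 0 x y +
      (if x ∈ ({o} : Set V) then 0 else N.av (fun v => N.harm {o, y} v y) x)
        ≤ N.harm {o, y} x y := by
  have hyA : y ∈ ({o, y} : Set V) := by simp
  have hoA : o ∈ ({o, y} : Set V) := by simp
  have huy : N.harm {o, y} y y = 1 := by rw [N.harm_on _ hyA]; simp
  have huo : N.harm {o, y} o y = 0 := by rw [N.harm_on _ hoA]; simp [Ne.symm hy]
  have hlt : N.av (fun v => N.harm {o, y} v y) y < 1 := by
    by_contra hge
    push Not at hge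
    have hall : ∀ x, N.harm {o, y} x y = 1 → ∀ z ∈ N.nb x, N.harm {o, y} z y = 1 := by
      intro x hx z hz
      refine N.max_step (f := fun v => N.harm {o, y} v y) (N.harm_le_one _ hyA) hx ?_ hz
      by_cases hxA : x ∈ ({o, y} : Set V)
      · rcases hxA with rfl | h
        · rw [huo] at hx; norm_num at hx
        · rw [Set.mem_singleton_iff.1 h]; exact hge
      · rw [N.harm_av _ hyA hxA, hx]
    have hgen : ∀ x, N.harm {o, y} x y = 1 := by
      intro x
      induction N.conn y x with
      | refl => exact huy
      | tail _ hbc ih => exact hall _ ih _ (N.mem_nb.2 hbc)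
    have := hgen o
    rw [huo] at this
    norm_num at this
  refine ⟨1 - N.av (fun v => N.harm {o, y} v y) y, sub_pos.2 hlt, fun x => ?_⟩
  simp only [avoid, Set.mem_singleton_iff]
  by_cases hxo : x = o
  · subst hxo
    simpa using N.harm_nonneg _ hyA x
  by_cases hxy : x = y
  · subst hxy
    simp [hxo, huy]
  · simp only [hxo, hxy, false_and, if_false, mul_zero, zero_add]
    exact (N.harm_av _ hyA (by simp [hxo, hxy])).le

lemma avoid_o (o n x) : N.avoid {o} n x o = 0 := by
  cases n with
  | zero =>
    simp only [avoid, Set.mem_singleton_iff]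
    rw [if_neg]
    rintro ⟨h, h'⟩
    exact h' h
  | succ n => simp [avoid_succ]

lemma green_summable_bound (o y : V) :
    ∃ C : ℝ, ∀ x, Summable (fun n => N.avoid {o} n x y) ∧ N.GreenK o x y ≤ C := by
  by_cases hy : y = o
  · subst hy
    refine ⟨0, fun x => ⟨?_, ?_⟩⟩
    · simp [avoid_o, summable_zero]
    · simp [GreenK, avoid_o]
  obtain ⟨ε, hε, h⟩ := N.green_bound o y hy
  have hyA : y ∈ ({o, y} : Set V) := by simp
  have hpos : ∀ n x, 0 ≤ ε * N.avoid {o} n x y :=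
    fun n x => mul_nonneg hε.le (N.avoid_nonneg _ _ _ _)
  have hb : ∀ n x, ε * N.avoid {o} (n + 1) x y
      = if x ∈ ({o} : Set V) then 0 else N.av (fun z => ε * N.avoid {o} n z y) x := by
    intro n x
    rw [avoid_succ', N.av_mul]
    split_ifs <;> simp
  refine ⟨ε⁻¹, fun x => ⟨?_, ?_⟩⟩
  · have := (N.lyap_summable {o} (fun n x => ε * N.avoid {o} n x y) _ (N.harm_nonneg _ hyA)
      hpos h hb x).mul_left ε⁻¹
    refine this.congr fun n => ?_
    rw [inv_mul_cancel_left₀ hε.ne']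
  · have := N.lyap_tsum_le {o} (fun n x => ε * N.avoid {o} n x y) _ (N.harm_nonneg _ hyA)
      hpos h hb x
    rw [tsum_mul_left] at this
    have h1 := this.trans (N.harm_le_one _ hyA x)
    rw [GreenK]
    rw [← one_div, le_div_iff₀ hε]
    linarith

lemma green_summable (o x y : V) : Summable (fun n => N.avoid {o} n x y) := by
  obtain ⟨C, hC⟩ := N.green_summable_bound o y
  exact (hC x).1

lemma g_nonneg (o x y : V) : 0 ≤ N.g o x y :=
  div_nonneg (tsum_nonneg fun _ => N.avoid_nonneg _ _ _ _) (N.cTot_pos y).le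

lemma g_bdd (o y : V) : ∃ C, ∀ x, |N.g o x y| ≤ C := by
  obtain ⟨C, hC⟩ := N.green_summable_bound o y
  refine ⟨C / N.cTot y, fun x => ?_⟩
  rw [abs_of_nonneg (N.g_nonneg o x y)]
  exact div_le_div_of_nonneg_right (hC x).2 (N.cTot_pos y).le

lemma g_symm (o x y : V) : N.g o x y = N.g o y x := by
  have hx := (N.cTot_pos x).ne'
  have hy := (N.cTot_pos y).ne'
  rw [g, g, div_eq_div_iff hy hx, GreenK, GreenK, ← tsum_mul_right, ← tsum_mul_right]
  refine tsum_congr fun n => ?_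
  rw [mul_comm, N.avoid_symm, mul_comm]

lemma g_right (o x : V) : N.g o x o = 0 := by simp [g, GreenK, avoid_o]

lemma g_left (o x : V) : N.g o o x = 0 := by rw [g_symm, g_right]

lemma g_lap (o y : V) {x : V} (hx : x ≠ o) :
    N.lap (fun v => N.g o v y) x = - if x = y then 1 else 0 := by
  have hg : (fun v => N.g o v y) = fun v => (N.cTot y)⁻¹ * N.GreenK o v y := by
    ext v; rw [g, div_eq_inv_mul]
  rw [hg, N.lap_mul, N.lap_eq]
  have hstep := N.tsum_step {o} (fun n x => N.avoid {o} n x y) (fun x => N.green_summable o x y)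
    (fun n x => N.avoid_succ' _ _ _ _) x
  simp only [Set.mem_singleton_iff, hx, if_false] at hstep
  have h2 : N.GreenK o x y = (if x = y then 1 else 0) + N.av (fun v => N.GreenK o v y) x := by
    simp only [GreenK]
    rw [hstep]
    congr 1
    simp [avoid, hx]
  rw [h2]
  by_cases h : x = y
  · subst h
    have := (N.cTot_pos x).ne'
    simp only [if_true]
    field_simp
    ring
  · simp [h]

variable {N}

lemma harm_root (hrec : N.Recurrent) (o v : V) : N.harm {o} v o = 1 := by
  have h := bdd_unique hrec (o := o) (f := fun v => N.harm {o} v o - 1) (C := 2) ?_ ?_ ?_ v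
  · linarith
  · intro x
    have := N.harm_abs {o} (z := o) rfl x
    rw [abs_le] at *
    constructor <;> linarith [this.1, this.2]
  · simp [N.harm_on {o} (z := o) (v := o) rfl]
  · intro x hx
    rw [N.lap_sub, N.lap_const, N.harm_lap {o} rfl hx, sub_zero]

lemma g_lap_root (hrec : N.Recurrent) (o y : V) (hy : y ≠ o) :
    N.lap (fun v => N.g o v y) o = 1 := by
  rw [← harm_root hrec o y, N.harm_off {o} rfl hy, lap_eq_sum]
  simp only [hitp]
  rw [Summable.tsum_finsetSum (fun w _ => (N.green_summable o y w).mul_right _)]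
  refine Finset.sum_congr rfl fun w _ => ?_
  rw [N.g_left, sub_zero, N.g_symm, tsum_mul_right, g, GreenK, p, N.symm o w]
  ring

/-- Finite Riesz representation. -/
lemma riesz (hrec : N.Recurrent) (o : V) (A : Finset V) {F : V → ℝ} {C : ℝ}
    (hC : ∀ x, |F x| ≤ C) (hF : ∀ x, x ∉ A → N.lap F x = 0) (v : V) :
    F v = F o + ∑ a ∈ A.erase o, (- N.lap F a) * N.g o v a := by
  choose B hB using N.g_bdd o
  have h := bdd_unique hrec (o := o)
    (f := fun v => F v - (F o + ∑ a ∈ A.erase o, (- N.lap F a) * N.g o v a))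
    (C := C + (|F o| + ∑ a ∈ A.erase o, |N.lap F a| * B a)) ?_ ?_ ?_ v
  · exact sub_eq_zero.1 h
  · intro x
    refine (abs_sub _ _).trans (add_le_add (hC x) ((abs_add_le _ _).trans ?_))
    gcongr
    refine (Finset.abs_sum_le_sum_abs _ _).trans (Finset.sum_le_sum fun a _ => ?_)
    rw [abs_mul, abs_neg]
    exact mul_le_mul_of_nonneg_left (hB a x) (abs_nonneg _)
  · simp [N.g_left]
  · intro x hx
    have e : ∀ y, F o + ∑ a ∈ A.erase o, (- N.lap F a) * N.g o y a
      = ∑ a ∈ A.erase o, (- N.lap F a) * N.g o y a - (- F o) := fun y => by ring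
    simp only [e]
    rw [N.lap_sub, N.lap_sub, N.lap_const, N.lap_sum]
    simp only [N.lap_mul, N.g_lap o _ hx]
    have e2 : ∀ a, -N.lap F a * -(if x = a then (1 : ℝ) else 0)
        = if x = a then N.lap F a else 0 := fun a => by split_ifs <;> ring
    simp only [e2, Finset.sum_ite_eq, sub_zero]
    split_ifs with h
    · ring
    · rw [hF x (fun h' => h (Finset.mem_erase.2 ⟨hx, h'⟩)), sub_zero]

lemma g_harm (hrec : N.Recurrent) (o v z : V) (hz : z ≠ o) :
    N.g o v z = N.harm {o, z} v z * N.g o z z := by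
  have hzA : z ∈ ({o, z} : Set V) := by simp
  have hoA : o ∈ ({o, z} : Set V) := by simp
  have hr := fun v => riesz hrec o {o, z} (F := fun v => N.harm {o, z} v z) (C := 1)
    (N.harm_abs _ hzA) (fun x hx => N.harm_lap _ hzA (by simpa using hx)) v
  have he : ({o, z} : Finset V).erase o = {z} := by
    ext x; simp only [Finset.mem_erase, Finset.mem_insert, Finset.mem_singleton]
    constructor
    · rintro ⟨h, h' | h'⟩
      · exact absurd h' h
      · exact h'
    · rintro rfl; exact ⟨hz, Or.inr rfl⟩
  simp only [he, Finset.sum_singleton, N.harm_on _ hoA, if_neg (Ne.symm hz), zero_add] at hr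
  have h1 := hr z
  rw [N.harm_on _ hzA, if_pos rfl] at h1
  rw [hr v, mul_right_comm, ← h1, one_mul]

/-- Limits of Green densities are potentials. -/
lemma limit_potential (hrec : N.Recurrent) (o : V) (l : Filter V) [l.NeBot]
    (hl : l ≤ Filter.cofinite) (h : V → ℝ)
    (hh : ∀ z, Tendsto (fun v => N.g o v z) l (𝓝 (h z))) : N.IsPotential o h := by
  have hlap : ∀ x, Tendsto (fun v => N.lap (fun z => N.g o z v) x) l (𝓝 (N.lap h x)) := by
    intro x
    simp only [lap_eq_sum]
    refine tendsto_finsetSum _ fun y _ => ?_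
    refine (((hh y).sub (hh x)).const_mul (N.c x y)).congr fun v => ?_
    rw [N.g_symm o v y, N.g_symm o v x]
  have hne : ∀ x, ∀ᶠ v in l, v ≠ x := fun x => hl (by simp)
  refine ⟨fun z => ge_of_tendsto' (hh z) fun v => N.g_nonneg _ _ _, ?_, ?_, ?_⟩
  · refine tendsto_nhds_unique (hh o) ?_
    simp only [N.g_right]
    exact tendsto_const_nhds
  · refine tendsto_nhds_unique (hlap o) (tendsto_const_nhds.congr' ?_)
    filter_upwards [hne o] with v hv
    rw [g_lap_root hrec o v hv]
  · intro x hx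
    refine tendsto_nhds_unique (hlap x) (tendsto_const_nhds.congr' ?_)
    filter_upwards [hne x] with v hv
    rw [N.g_lap o v hx, if_neg (Ne.symm hv), neg_zero]

/-- If the potential is unique, the Green densities converge to it. -/
lemma tendsto_of_unique (hrec : N.Recurrent) (o : V) (h : V → ℝ)
    (hu : ∀ h', N.IsPotential o h' → h' = h) (z : V) :
    Tendsto (fun v => N.g o v z) Filter.cofinite (𝓝 (h z)) := by
  rw [tendsto_iff_ultrafilter]
  intro U hU
  have hex : ∀ z, ∃ a, Tendsto (fun v => N.g o v z) U (𝓝 a) := by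
    intro z
    obtain ⟨C, hC⟩ := N.g_bdd o z
    obtain ⟨a, _, ha⟩ := (isCompact_Icc (a := -C) (b := C)).ultrafilter_le_nhds
      (U.map fun v => N.g o v z) (by
        rw [le_principal_iff]
        exact Filter.mem_map.2 (Filter.univ_mem' fun v => abs_le.1 (hC v)))
    exact ⟨a, ha⟩
  choose k hk using hex
  have := hu k (limit_potential hrec o U hU k hk)
  rw [← this]
  exact hk z

/-- Convergence of all harmonic measures from convergence of the Green densities. -/
lemma harm_tendsto (hrec : N.Recurrent) (o : V) (h : V → ℝ)
    (hh : ∀ z, Tendsto (fun v => N.g o v z) Filter.cofinite (𝓝 (h z)))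
    (A : Set V) (hA : A.Finite) (z : V) (hz : z ∈ A) :
    ∃ l : ℝ, Tendsto (fun v => N.harm A v z) Filter.cofinite (𝓝 l) := by
  have hr := fun v => riesz hrec o hA.toFinset (F := fun v => N.harm A v z) (C := 1)
    (N.harm_abs _ hz) (fun x hx => N.harm_lap _ hz (by simpa using hx)) v
  rw [show (fun v => N.harm A v z) = _ from funext hr]
  exact ⟨_, tendsto_const_nhds.add (tendsto_finsetSum _ fun a _ => (hh a).const_mul _)⟩

/-- Potentials are averages of Green densities based far away. -/
lemma potential_avg (hrec : N.Recurrent) (o : V) {h : V → ℝ} (hp : N.IsPotential o h)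
    (K : Finset V) (hoK : o ∈ K) (hnK : N.nb o ⊆ K) :
    ∃ μ : V → ℝ, (∀ a ∈ K.erase o, 0 ≤ μ a) ∧ (∀ a ∈ K.erase o, N.nb a ⊆ K → μ a = 0) ∧
      ∑ a ∈ K.erase o, μ a = 1 ∧ ∀ z ∈ K, h z = ∑ a ∈ K.erase o, μ a * N.g o z a := by
  obtain ⟨h0, ho, hlo, hl⟩ := hp
  set F : V → ℝ := fun v => ∑ a ∈ K, h a * N.harm K v a with hF
  have hFon : ∀ v ∈ K, F v = h v := by
    intro v hv
    have : ∀ a, h a * N.harm K v a = if v = a then h a else 0 := by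
      intro a
      rw [N.harm_on (K : Set V) (by exact_mod_cast hv)]
      simp
    simp only [hF, this]
    rw [Finset.sum_ite_eq, if_pos hv]
  have hFlap : ∀ v, v ∉ K → N.lap F v = 0 := by
    intro v hv
    rw [hF, N.lap_sum]
    refine Finset.sum_eq_zero fun a ha => ?_
    rw [N.lap_mul, N.harm_lap (K : Set V) (by exact_mod_cast ha) (by exact_mod_cast hv), mul_zero]
  have hF0 : ∀ v, 0 ≤ F v := fun v => Finset.sum_nonneg fun a ha =>
    mul_nonneg (h0 a) (N.harm_nonneg (K : Set V) (by exact_mod_cast ha) v)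
  have hFC : ∀ v, F v ≤ ∑ a ∈ K, h a := fun v => Finset.sum_le_sum fun a ha =>
    mul_le_of_le_one_right (h0 a) (N.harm_le_one (K : Set V) (by exact_mod_cast ha) v)
  have hFh : ∀ v, 0 ≤ h v - F v := by
    refine min_principle hrec (A := (K : Set V)) (o := o) (by exact_mod_cast hoK)
      (C := ∑ a ∈ K, h a) ?_ ?_ ?_
    · intro x; linarith [h0 x, hFC x]
    · intro x hx; rw [hFon x (by exact_mod_cast hx), sub_self]
    · intro x hx
      have hx' : x ∉ K := by exact_mod_cast hx
      rw [N.lap_sub, hFlap x hx', hl x (fun e => hx' (e ▸ hoK)), sub_zero]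
  have hloc : ∀ a ∈ K, N.nb a ⊆ K → N.lap F a = N.lap h a := by
    intro a ha hs
    rw [lap_eq_sum, lap_eq_sum]
    refine Finset.sum_congr rfl fun y hy => ?_
    rw [hFon a ha, hFon y (hs hy)]
  have hr := riesz hrec o K (F := F) (C := ∑ a ∈ K, h a)
    (fun x => by rw [abs_of_nonneg (hF0 x)]; exact hFC x) hFlap
  rw [hFon o hoK, ho] at hr
  simp only [zero_add] at hr
  refine ⟨fun a => - N.lap F a, ?_, ?_, ?_, ?_⟩
  · intro a ha
    have haK := Finset.mem_of_mem_erase ha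
    have hao := Finset.ne_of_mem_erase ha
    rw [neg_nonneg, ← hl a hao, lap_eq_sum, lap_eq_sum]
    refine Finset.sum_le_sum fun y _ => mul_le_mul_of_nonneg_left ?_ (N.nonneg _ _)
    rw [hFon a haK]
    linarith [hFh y]
  · intro a ha hs
    beta_reduce
    rw [hloc a (Finset.mem_of_mem_erase ha) hs, hl a (Finset.ne_of_mem_erase ha), neg_zero]
  · have h1 : N.lap F o = 1 := by rw [hloc o hoK hnK, hlo]
    have h2 : N.lap F o = N.lap (fun v => ∑ a ∈ K.erase o, (- N.lap F a) * N.g o v a) o := by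
      congr 1
      exact funext hr
    rw [h1, N.lap_sum] at h2
    rw [h2]
    refine Finset.sum_congr rfl fun a ha => ?_
    rw [N.lap_mul, g_lap_root hrec o a (Finset.ne_of_mem_erase ha), mul_one]
  · intro z hz
    rw [← hFon z hz]
    exact hr z

lemma potential_eq_limit (hrec : N.Recurrent) (o : V) {h k : V → ℝ} (hp : N.IsPotential o h)
    (hk : ∀ z, Tendsto (fun v => N.g o v z) Filter.cofinite (𝓝 (k z))) : h = k := by
  ext z
  refine eq_of_abs_sub_le_all fun ε hε => ?_
  have hE := (Metric.tendsto_nhds.1 (hk z)) ε hε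
  rw [Filter.eventually_cofinite] at hE
  set E := hE.toFinset with hEdef
  obtain ⟨μ, hμ0, hμi, hμ1, hμ⟩ := potential_avg hrec o hp
    ({o, z} ∪ N.nb o ∪ E ∪ E.biUnion N.nb) (by simp) (fun x hx => by simp [hx])
  rw [hμ z (by simp)]
  set K := ({o, z} ∪ N.nb o ∪ E ∪ E.biUnion N.nb : Finset V) with hK
  have e : ∑ a ∈ K.erase o, μ a * N.g o z a - k z
      = ∑ a ∈ K.erase o, μ a * (N.g o z a - k z) := by
    simp only [mul_sub, Finset.sum_sub_distrib, ← Finset.sum_mul, hμ1, one_mul]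
  rw [e]
  refine (Finset.abs_sum_le_sum_abs _ _).trans ?_
  have : ε = ∑ a ∈ K.erase o, μ a * ε := by rw [← Finset.sum_mul, hμ1, one_mul]
  rw [this]
  refine Finset.sum_le_sum fun a ha => ?_
  rw [abs_mul, abs_of_nonneg (hμ0 a ha)]
  by_cases haE : a ∈ E
  · rw [hμi a ha, zero_mul, zero_mul]
    intro x hx
    rw [hK]
    simp only [Finset.mem_union, Finset.mem_biUnion]
    exact Or.inr ⟨a, haE, hx⟩
  · refine mul_le_mul_of_nonneg_left ?_ (hμ0 a ha)
    rw [hEdef, Set.Finite.mem_toFinset, Set.mem_setOf_eq, not_not] at haE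
    rw [N.g_symm, ← Real.dist_eq]
    exact haE.le

end Network

/-- A recurrent rooted network has a unique potential if and only if every
finite set admits harmonic measure from infinity; in that case the unique potential
satisfies `h(z) = ω_∞^{{o,z}}(z) · g_o(z,z)` for every `z ≠ o`. -/
theorem unique_potential_iff_harmonic_measure_from_infinity {V : Type*}
    (N : Network V) (hrec : N.Recurrent) (o : V) :
    ((∃! h, N.IsPotential o h) ↔
      ∀ A : Set V, A.Finite → ∀ z ∈ A,
        ∃ l : ℝ, Filter.Tendsto (fun v => N.harm A v z) Filter.cofinite (nhds l)) ∧
    (∀ h : V → ℝ, N.IsPotential o h → (∀ h', N.IsPotential o h' → h' = h) →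
      ∀ z : V, z ≠ o → ∀ l : ℝ,
        Filter.Tendsto (fun v => N.harm {o, z} v z) Filter.cofinite (nhds l) →
        h z = l * N.g o z z) := by
  refine ⟨⟨?_, ?_⟩, ?_⟩
  · rintro ⟨h, _, hu⟩ A hA z hz
    exact Network.harm_tendsto hrec o h (Network.tendsto_of_unique hrec o h hu) A hA z hz
  · intro H
    have hex : ∀ z, ∃ a, Tendsto (fun v => N.g o v z) Filter.cofinite (𝓝 a) := by
      intro z
      by_cases hz : z = o
      · subst hz
        simp only [N.g_right]
        exact ⟨0, tendsto_const_nhds⟩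
      · obtain ⟨l, hl⟩ := H {o, z} (by simp) z (by simp)
        exact ⟨_, (hl.mul_const (N.g o z z)).congr
          fun v => (Network.g_harm hrec o v z hz).symm⟩
    choose k hk using hex
    have := N.infinite
    exact ⟨k, Network.limit_potential hrec o _ le_rfl k hk,
      fun h' hh' => Network.potential_eq_limit hrec o hh' hk⟩
  · intro h hp hu z hz l hl
    have := N.infinite
    have h1 := Network.tendsto_of_unique hrec o h hu z
    exact tendsto_nhds_unique h1 ((hl.mul_const (N.g o z z)).congr
      fun v => (Network.g_harm hrec o v z hz).symm)
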